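/- arXiv:1404.2216 — 2 statements merged into one kernel-verified Lean document; each statement's English description precedes it below -/
import Mathlib

section
/- There exists an absolute constant C > 0 such that for every sequence λ = (λ_{IJ}), ‖λ‖_{X'} ≤ C ‖λ‖_{BMO_prod}. In particular, membership of λ in dyadic product BMO implies the unconditional L²(ℝ²)-boundedness of the mixed paraproduct P_λ. -/
open MeasureTheory
open scoped ENNReal

noncomputable section

/-- A sequence `λ = (λ_{IJ})` indexed by pairs of dyadic intervals; a dyadic interval
`[2^{-i}k, 2^{-i}(k+1))` is encoded by the pair `(i, k) : ℤ × ℤ`. -/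
abbrev ParaSeq := (ℤ × ℤ) → (ℤ × ℤ) → ℝ

/-- The dyadic interval `[2^{-i} k, 2^{-i}(k+1))` encoded by the pair `p = (i, k) : ℤ × ℤ`. -/
def dyadic (p : ℤ × ℤ) : Set ℝ := Set.Ico ((2:ℝ) ^ (-p.1) * p.2) ((2:ℝ) ^ (-p.1) * (p.2 + 1))

/-- The length `|I| = 2^{-i}` of the dyadic interval encoded by `p = (i, k)`. -/
def dlen (p : ℤ × ℤ) : ℝ := (2:ℝ) ^ (-p.1)

/-- The average `⟨f⟩_I = |I|⁻¹ ∫_I f`. -/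
def avg (f : ℝ → ℝ) (p : ℤ × ℤ) : ℝ := (dlen p)⁻¹ * ∫ x in dyadic p, f x

/-- Admissible families `(u_I)_{I ∈ D}` of `L²(ℝ)` functions: only finitely many nonzero
members and `Σ_I ‖u_I‖₂² = 1`. -/
def Adm : Set ((ℤ × ℤ) → ℝ → ℝ) :=
  {u | (∀ p, MemLp (u p) 2 volume) ∧ {p | u p ≠ 0}.Finite ∧ (∑' p : ℤ × ℤ, ∫ x, (u p x) ^ 2) = 1}

/-- The bilinear sum `Σ_{I,J} λ_{IJ} ⟨g_J⟩_I ⟨u_I⟩_J`. -/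
def pairSum (lam : ParaSeq) (u g : (ℤ × ℤ) → ℝ → ℝ) : ℝ :=
  ∑' pq : (ℤ × ℤ) × (ℤ × ℤ), lam pq.1 pq.2 * avg (g pq.2) pq.1 * avg (u pq.1) pq.2

/-- The norm `‖λ‖_X`, as an element of `[0, ∞]`. -/
def Xnorm (lam : ParaSeq) : ℝ≥0∞ :=
  ⨆ (u : Adm) (g : Adm), ENNReal.ofReal |pairSum lam u.1 g.1|

/-- The norm `‖λ‖_{X'}`, as an element of `[0, ∞]`. -/
def Xprime (lam : ParaSeq) : ℝ≥0∞ :=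
  ⨆ (u : Adm) (g : Adm),
    ENNReal.ofReal
      (∑' pq : (ℤ × ℤ) × (ℤ × ℤ), |lam pq.1 pq.2 * avg (g.1 pq.2) pq.1 * avg (u.1 pq.1) pq.2|)

/-- Admissible sets `Ω` for product BMO: finite positive measure, and every point of `Ω`
lies in a dyadic rectangle contained in `Ω`. -/
def ProdOpen : Set (Set (ℝ × ℝ)) :=
  {Ω | MeasurableSet Ω ∧ 0 < volume Ω ∧ volume Ω < ⊤ ∧
    ∀ z ∈ Ω, ∃ p q : ℤ × ℤ, z ∈ dyadic p ×ˢ dyadic q ∧ dyadic p ×ˢ dyadic q ⊆ Ω}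

/-- The dyadic product BMO norm `‖λ‖_{BMO_prod}`, as an element of `[0, ∞]`. -/
def prodBMO (lam : ParaSeq) : ℝ≥0∞ :=
  ⨆ Ω : ProdOpen,
    ((volume Ω.1)⁻¹ *
      ∑' r : {r : (ℤ × ℤ) × (ℤ × ℤ) // dyadic r.1 ×ˢ dyadic r.2 ⊆ Ω.1},
        ENNReal.ofReal ((lam r.1.1 r.1.2) ^ 2)) ^ (1/2 : ℝ)

theorem measurableSet_dyadic (p : ℤ × ℤ) : MeasurableSet (dyadic p) := measurableSet_Ico

theorem volume_dyadic (p : ℤ × ℤ) : volume (dyadic p) = ENNReal.ofReal (dlen p) := by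
  rw [dyadic, Real.volume_Ico, dlen]
  congr 1
  ring

theorem dlen_pos (p : ℤ × ℤ) : 0 < dlen p := by
  unfold dlen
  positivity

theorem volume_dyadic_ne_zero (p : ℤ × ℤ) : volume (dyadic p) ≠ 0 := by
  rw [volume_dyadic]
  simpa using dlen_pos p

theorem volume_dyadic_ne_top (p : ℤ × ℤ) : volume (dyadic p) ≠ ⊤ := by
  rw [volume_dyadic]
  exact ENNReal.ofReal_ne_top

theorem mem_dyadic_iff (p : ℤ × ℤ) (x : ℝ) : x ∈ dyadic p ↔ ⌊x * (2 : ℝ) ^ p.1⌋ = p.2 := by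
  have h : (0 : ℝ) < 2 ^ p.1 := by positivity
  rw [Int.floor_eq_iff, dyadic, Set.mem_Ico, zpow_neg, inv_mul_le_iff₀ h, lt_inv_mul_iff₀ h,
    mul_comm x]

/-- A dyadic interval is either contained in or disjoint from any dyadic interval that is at least
as long. -/
theorem dyadic_subset_or_disjoint {p q : ℤ × ℤ} (h : p.1 ≤ q.1) :
    dyadic q ⊆ dyadic p ∨ Disjoint (dyadic q) (dyadic p) := by
  obtain ⟨n, hn⟩ := Int.eq_ofNat_of_zero_le (sub_nonneg.2 h)
  have key : ∀ x ∈ dyadic q, ⌊x * (2 : ℝ) ^ p.1⌋ = q.2 / 2 ^ n := by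
    intro x hx
    rw [← (mem_dyadic_iff q x).1 hx]
    have := Int.mul_cast_floor_div_cancel_of_pos (n := 2 ^ n) (by positivity) (x * (2 : ℝ) ^ p.1)
    rw [← this]
    congr 2
    have hq : q.1 = p.1 + n := by lia
    rw [hq, zpow_add₀ (by norm_num)]
    push_cast
    rw [zpow_natCast, mul_assoc]
  by_cases hp : q.2 / 2 ^ n = p.2
  · exact Or.inl fun x hx => (mem_dyadic_iff p x).2 ((key x hx).trans hp)
  · refine Or.inr (Set.disjoint_left.2 fun x hx hx' => hp ?_)
    rw [← key x hx, (mem_dyadic_iff p x).1 hx']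

/-- Finite unions of dyadic intervals inherit an inequality between two measures. -/
theorem measure_biUnion_dyadic_le {μ ν : Measure ℝ} (F : Finset (ℤ × ℤ))
    (h : ∀ p ∈ F, μ (dyadic p) ≤ ν (dyadic p)) :
    μ (⋃ p ∈ F, dyadic p) ≤ ν (⋃ p ∈ F, dyadic p) := by
  induction F using Finset.induction_on_max_value (fun p : ℤ × ℤ => p.1) with
  | empty => simp
  | insert a s _ hmax ih =>
    have ih' := ih fun p hp => h p (Finset.mem_insert_of_mem hp)
    rw [Finset.set_biUnion_insert]
    by_cases hsub : ∃ p ∈ s, dyadic a ⊆ dyadic p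
    · obtain ⟨p, hp, hap⟩ := hsub
      have : dyadic a ∪ ⋃ p ∈ s, dyadic p = ⋃ p ∈ s, dyadic p :=
        Set.union_eq_self_of_subset_left (hap.trans (Set.subset_biUnion_of_mem (u := dyadic) hp))
      rwa [this]
    · push Not at hsub
      have hd : Disjoint (dyadic a) (⋃ p ∈ s, dyadic p) := by
        rw [Set.disjoint_iUnion₂_right]
        exact fun p hp => (dyadic_subset_or_disjoint (hmax p hp)).resolve_left (hsub p hp)
      have hm : MeasurableSet (⋃ p ∈ s, dyadic p) :=
        s.measurableSet_biUnion fun p _ => measurableSet_dyadic p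
      rw [measure_union hd hm, measure_union hd hm]
      exact add_le_add (h a (Finset.mem_insert_self a s)) ih'

theorem sq_lintegral_mul_le {α : Type*} [MeasurableSpace α] {μ : Measure α} {f g : α → ℝ≥0∞}
    (hf : AEMeasurable f μ) (hg : AEMeasurable g μ) :
    (∫⁻ x, f x * g x ∂μ) ^ 2 ≤ (∫⁻ x, f x ^ 2 ∂μ) * ∫⁻ x, g x ^ 2 ∂μ := by
  have h := ENNReal.lintegral_mul_le_Lp_mul_Lq μ Real.HolderConjugate.two_two hf hg
  simp only [Pi.mul_apply, ENNReal.rpow_two] at h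
  rw [← ENNReal.mul_rpow_of_nonneg _ _ (by norm_num)] at h
  calc _ ≤ _ := pow_le_pow_left₀ zero_le h 2
    _ = _ := by
      rw [← ENNReal.rpow_two, ← ENNReal.rpow_mul]
      norm_num

theorem sq_sum_mul_le {ι : Type*} (s : Finset ι) (f g : ι → ℝ≥0∞) :
    (∑ i ∈ s, f i * g i) ^ 2 ≤ (∑ i ∈ s, f i ^ 2) * ∑ i ∈ s, g i ^ 2 := by
  have h := ENNReal.inner_le_Lp_mul_Lq s f g Real.HolderConjugate.two_two
  simp only [ENNReal.rpow_two] at h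
  rw [← ENNReal.mul_rpow_of_nonneg _ _ (by norm_num)] at h
  calc _ ≤ _ := pow_le_pow_left₀ zero_le h 2
    _ = _ := by
      rw [← ENNReal.rpow_two, ← ENNReal.rpow_mul]
      norm_num

/-- Jensen's inequality for `t ↦ t⁻²`, in multiplicative form. -/
theorem measure_pow_three_le {α : Type*} [MeasurableSpace α] {μ : Measure α} {s : Set α}
    (hs : MeasurableSet s) {f : α → ℝ≥0∞} (hf : Measurable f)
    (h0 : ∀ x ∈ s, f x ≠ 0) (ht : ∀ x ∈ s, f x ≠ ⊤) :
    μ s ^ 3 ≤ (∫⁻ x in s, f x ∂μ) ^ 2 * ∫⁻ x in s, (f x ^ 2)⁻¹ ∂μ := by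
  have hc : Real.HolderConjugate (3 / 2) 3 := by
    rw [Real.holderConjugate_iff]
    norm_num
  have h := ENNReal.lintegral_mul_le_Lp_mul_Lq (μ.restrict s) hc
    (f := fun x => f x ^ (2 / 3 : ℝ)) (g := fun x => (f x ^ (2 / 3 : ℝ))⁻¹)
    (by fun_prop) (by fun_prop)
  have h1 : ∫⁻ x in s, ((fun x => f x ^ (2 / 3 : ℝ)) * fun x => (f x ^ (2 / 3 : ℝ))⁻¹) x ∂μ
      = μ s := by
    rw [← setLIntegral_one]
    refine setLIntegral_congr_fun hs fun x hx => ?_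
    refine ENNReal.mul_inv_cancel ?_ ?_
    · simp [ENNReal.rpow_eq_zero_iff, h0 x hx, ht x hx]
    · simp [ENNReal.rpow_eq_top_iff, h0 x hx, ht x hx]
  have h2 : ∀ x, (f x ^ (2 / 3 : ℝ)) ^ (3 / 2 : ℝ) = f x := fun x => by
    rw [← ENNReal.rpow_mul]
    norm_num
  have h3 : ∀ x, ((f x ^ (2 / 3 : ℝ))⁻¹) ^ (3 : ℝ) = (f x ^ 2)⁻¹ := fun x => by
    rw [ENNReal.inv_rpow, ← ENNReal.rpow_mul, ← ENNReal.rpow_two]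
    norm_num
  rw [h1] at h
  simp only [h2, h3] at h
  calc _ ≤ _ := pow_le_pow_left₀ zero_le h 3
    _ = _ := by
      rw [mul_pow, ← ENNReal.rpow_natCast, ← ENNReal.rpow_mul, ← ENNReal.rpow_natCast,
        ← ENNReal.rpow_mul]
      norm_num

theorem lintegral_eq_lintegral_measure_lt {α : Type*} [MeasurableSpace α] (μ : Measure α)
    {f : α → ℝ≥0∞} (hf : Measurable f) (ht : ∀ x, f x ≠ ⊤) :
    ∫⁻ x, f x ∂μ = ∫⁻ s in Set.Ioi (0 : ℝ), μ {x | ENNReal.ofReal s < f x} := by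
  have h := lintegral_eq_lintegral_meas_lt μ (f := fun x => (f x).toReal)
    (Filter.Eventually.of_forall fun x => ENNReal.toReal_nonneg) hf.ennreal_toReal.aemeasurable
  simp only [ENNReal.ofReal_toReal (ht _)] at h
  rw [h]
  refine setLIntegral_congr_fun measurableSet_Ioi fun s hs => ?_
  simp only [ENNReal.ofReal_lt_iff_lt_toReal (le_of_lt hs) (ht _)]

theorem lintegral_sq_eq_lintegral_measure_lt {α : Type*} [MeasurableSpace α] (μ : Measure α)
    {f : α → ℝ≥0∞} (hf : Measurable f) (ht : ∀ x, f x ≠ ⊤) :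
    ∫⁻ x, f x ^ 2 ∂μ
      = 2 * ∫⁻ s in Set.Ioi (0 : ℝ), μ {x | ENNReal.ofReal s < f x} * ENNReal.ofReal s := by
  have h := lintegral_rpow_eq_lintegral_meas_lt_mul μ (f := fun x => (f x).toReal)
    (Filter.Eventually.of_forall fun x => ENNReal.toReal_nonneg) hf.ennreal_toReal.aemeasurable
    two_pos
  have h2 : ∀ x, ENNReal.ofReal ((f x).toReal ^ (2 : ℝ)) = f x ^ 2 := fun x => by
    rw [Real.rpow_two, ENNReal.ofReal_pow ENNReal.toReal_nonneg, ENNReal.ofReal_toReal (ht x)]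
  simp only [h2] at h
  rw [h]
  congr 1
  · simp
  refine setLIntegral_congr_fun measurableSet_Ioi fun s hs => ?_
  simp only [ENNReal.ofReal_lt_iff_lt_toReal (le_of_lt hs) (ht _)]
  norm_num

theorem measurable_finset_sup {α ι : Type*} [MeasurableSpace α] (F : Finset ι)
    {g : ι → α → ℝ≥0∞} (hg : ∀ i ∈ F, Measurable (g i)) :
    Measurable fun x => F.sup fun i => g i x := by
  classical
  induction F using Finset.induction_on with
  | empty => simp
  | insert a s _ ih =>
    simp only [Finset.sup_insert]
    exact (hg a (Finset.mem_insert_self a s)).sup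
      (ih fun i hi => hg i (Finset.mem_insert_of_mem hi))

/-- The pointwise supremum of finitely many constants `t i`, each supported on the set `E i`. -/
def supInd {α ι : Type*} (F : Finset ι) (E : ι → Set α) (t : ι → ℝ≥0∞) (x : α) : ℝ≥0∞ :=
  F.sup fun i => (E i).indicator (fun _ => t i) x

section supInd

variable {α ι : Type*} {F : Finset ι} {E : ι → Set α} {t : ι → ℝ≥0∞}

theorem measurable_supInd [MeasurableSpace α] (hE : ∀ i, MeasurableSet (E i)) :
    Measurable (supInd F E t) :=
  measurable_finset_sup F fun i _ => measurable_const.indicator (hE i)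

theorem le_supInd {i : ι} (hi : i ∈ F) {x : α} (hx : x ∈ E i) : t i ≤ supInd F E t x := by
  have h := Finset.le_sup (f := fun i => (E i).indicator (fun _ => t i) x) hi
  rwa [Set.indicator_of_mem hx] at h

theorem supInd_le {x : α} {c : ℝ≥0∞} (h : ∀ i ∈ F, x ∈ E i → t i ≤ c) : supInd F E t x ≤ c := by
  refine Finset.sup_le fun i hi => ?_
  by_cases hx : x ∈ E i
  · rw [Set.indicator_of_mem hx]
    exact h i hi hx
  · rw [Set.indicator_of_notMem hx]
    exact zero_le

theorem setOf_lt_supInd (s : ℝ≥0∞) :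
    {x | s < supInd F E t x} = ⋃ i ∈ F.filter (fun i => s < t i), E i := by
  ext x
  simp only [supInd, Set.mem_ofPred_eq, Finset.lt_sup_iff, Set.mem_iUnion, Finset.mem_filter,
    exists_prop]
  refine exists_congr fun p => ⟨fun ⟨hp, h⟩ => ?_, fun ⟨⟨hp, h⟩, hx⟩ => ⟨hp, ?_⟩⟩
  · by_cases hx : x ∈ E p
    · rw [Set.indicator_of_mem hx] at h
      exact ⟨⟨hp, h⟩, hx⟩
    · rw [Set.indicator_of_notMem hx] at h
      exact absurd h not_lt_zero
  · rwa [Set.indicator_of_mem hx]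

theorem supInd_ne_top (h : ∀ i ∈ F, t i ≠ ⊤) (x : α) : supInd F E t x ≠ ⊤ := by
  rw [← lt_top_iff_ne_top, supInd, Finset.sup_lt_iff ENNReal.zero_lt_top]
  intro p hp
  by_cases hx : x ∈ E p
  · rw [Set.indicator_of_mem hx]
    exact (h p hp).lt_top
  · rw [Set.indicator_of_notMem hx]
    exact ENNReal.zero_lt_top

end supInd

/-- The average over a dyadic interval of a function with values in `[0, ∞]`. -/
def lavg (f : ℝ → ℝ≥0∞) (p : ℤ × ℤ) : ℝ≥0∞ := (volume (dyadic p))⁻¹ * ∫⁻ x in dyadic p, f x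

theorem lavg_mono {f g : ℝ → ℝ≥0∞} {p : ℤ × ℤ} (h : ∀ x ∈ dyadic p, f x ≤ g x) :
    lavg f p ≤ lavg g p :=
  mul_le_mul_right (setLIntegral_mono' (measurableSet_dyadic p) h) _

/-- The dyadic maximal function over a finite set of dyadic intervals. -/
def dmax (F : Finset (ℤ × ℤ)) (f : ℝ → ℝ≥0∞) : ℝ → ℝ≥0∞ := supInd F dyadic (lavg f)

theorem measurable_dmax (F : Finset (ℤ × ℤ)) (f : ℝ → ℝ≥0∞) : Measurable (dmax F f) :=
  measurable_supInd measurableSet_dyadic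

/-- The weak-type estimate for the dyadic maximal function. -/
theorem mul_volume_lt_dmax_le (F : Finset (ℤ × ℤ)) (f : ℝ → ℝ≥0∞) (s : ℝ≥0∞) :
    s * volume {x | s < dmax F f x} ≤ volume.withDensity f {x | s < dmax F f x} := by
  rw [dmax, setOf_lt_supInd, ← smul_eq_mul, ← Measure.smul_apply]
  refine measure_biUnion_dyadic_le _ fun p hp => ?_
  have h := (Finset.mem_filter.1 hp).2.le
  rw [Measure.smul_apply, smul_eq_mul, withDensity_apply _ (measurableSet_dyadic p)]
  calc _ ≤ lavg f p * volume (dyadic p) := mul_le_mul_left h _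
    _ = _ := by
      rw [lavg, mul_right_comm,
        ENNReal.inv_mul_cancel (volume_dyadic_ne_zero p) (volume_dyadic_ne_top p), one_mul]

theorem lavg_ne_top {f : ℝ → ℝ≥0∞} (hf : Measurable f) (h : ∫⁻ x, f x ^ 2 ≠ ⊤) (p : ℤ × ℤ) :
    lavg f p ≠ ⊤ := by
  refine ENNReal.mul_ne_top (ENNReal.inv_ne_top.2 (volume_dyadic_ne_zero p)) fun hT => ?_
  have h1 := sq_lintegral_mul_le (μ := volume.restrict (dyadic p)) hf.aemeasurable
    (aemeasurable_const (b := (1 : ℝ≥0∞)))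
  simp only [mul_one, hT, one_pow, lintegral_one, Measure.restrict_apply_univ] at h1
  simp only [ne_eq, OfNat.ofNat_ne_zero, not_false_eq_true, ENNReal.top_pow] at h1
  refine ENNReal.mul_ne_top (ne_top_of_le_ne_top h (setLIntegral_le_lintegral (dyadic p) _))
    (volume_dyadic_ne_top p) (top_le_iff.1 h1)

theorem lintegral_dmax_sq_ne_top {F : Finset (ℤ × ℤ)} {f : ℝ → ℝ≥0∞}
    (h : ∀ p ∈ F, lavg f p ≠ ⊤) : ∫⁻ x, dmax F f x ^ 2 ≠ ⊤ := by
  have hle : ∀ x, dmax F f x ^ 2 ≤ ∑ p ∈ F, (dyadic p).indicator (fun _ => lavg f p ^ 2) x := by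
    intro x
    rcases F.eq_empty_or_nonempty with rfl | hF
    · simp [dmax, supInd]
    · obtain ⟨p, hp, hpe⟩ := F.exists_mem_eq_sup hF
        fun p => (dyadic p).indicator (fun _ => lavg f p) x
      rw [dmax, supInd, hpe]
      refine le_trans ?_ (Finset.single_le_sum (fun _ _ => zero_le) hp)
      by_cases hx : x ∈ dyadic p <;> simp [hx]
  refine ne_top_of_le_ne_top ?_ (lintegral_mono hle)
  rw [lintegral_finsetSum _ fun p _ => measurable_const.indicator (measurableSet_dyadic p)]
  refine ENNReal.sum_ne_top.2 fun p hp => ?_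
  rw [lintegral_indicator_const (measurableSet_dyadic p)]
  exact ENNReal.mul_ne_top (ENNReal.pow_ne_top (h p hp)) (volume_dyadic_ne_top p)

/-- The dyadic maximal function is bounded on `L²`. -/
theorem lintegral_dmax_sq_le (F : Finset (ℤ × ℤ)) {f : ℝ → ℝ≥0∞} (hf : Measurable f) :
    ∫⁻ x, dmax F f x ^ 2 ≤ 4 * ∫⁻ x, f x ^ 2 := by
  by_cases htop : ∫⁻ x, f x ^ 2 = ⊤
  · simp [htop]
  have hfin := fun p (_ : p ∈ F) => lavg_ne_top hf htop p
  have hm := measurable_dmax F f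
  have h1 : ∫⁻ x, dmax F f x ^ 2 ≤ 2 * ∫⁻ x, f x * dmax F f x := by
    rw [lintegral_sq_eq_lintegral_measure_lt _ hm (supInd_ne_top hfin)]
    have h2 : ∫⁻ x, f x * dmax F f x = ∫⁻ x, dmax F f x ∂(volume.withDensity f) := by
      rw [lintegral_withDensity_eq_lintegral_mul _ hf hm]
      rfl
    rw [h2, lintegral_eq_lintegral_measure_lt _ hm (supInd_ne_top hfin)]
    gcongr with s
    rw [mul_comm]
    exact mul_volume_lt_dmax_le F f _
  have h3 := lintegral_dmax_sq_ne_top hfin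
  set A := ∫⁻ x, dmax F f x ^ 2
  by_cases hA : A = 0
  · rw [hA]
    exact zero_le
  rw [← ENNReal.mul_le_mul_iff_left hA h3]
  calc A * A = A ^ 2 := (sq A).symm
    _ ≤ (2 * ∫⁻ x, f x * dmax F f x) ^ 2 := pow_le_pow_left₀ zero_le h1 2
    _ ≤ 4 * ((∫⁻ x, f x ^ 2) * A) := by
      rw [mul_pow]
      norm_num
      gcongr
      exact sq_lintegral_mul_le hf.aemeasurable hm.aemeasurable
    _ = _ := by ring

/-- The dyadic rectangle encoded by a pair of dyadic intervals. -/
def drect (r : (ℤ × ℤ) × (ℤ × ℤ)) : Set (ℝ × ℝ) := dyadic r.1 ×ˢ dyadic r.2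

theorem measurableSet_drect (r : (ℤ × ℤ) × (ℤ × ℤ)) : MeasurableSet (drect r) :=
  (measurableSet_dyadic r.1).prod (measurableSet_dyadic r.2)

theorem volume_drect (r : (ℤ × ℤ) × (ℤ × ℤ)) :
    volume (drect r) = volume (dyadic r.1) * volume (dyadic r.2) := by
  rw [drect, Measure.volume_eq_prod, Measure.prod_prod]

theorem volume_drect_ne_zero (r : (ℤ × ℤ) × (ℤ × ℤ)) : volume (drect r) ≠ 0 := by
  rw [volume_drect]
  exact mul_ne_zero (volume_dyadic_ne_zero _) (volume_dyadic_ne_zero _)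

theorem volume_drect_ne_top (r : (ℤ × ℤ) × (ℤ × ℤ)) : volume (drect r) ≠ ⊤ := by
  rw [volume_drect]
  exact ENNReal.mul_ne_top (volume_dyadic_ne_top _) (volume_dyadic_ne_top _)

/-- The average over a dyadic rectangle of a function with values in `[0, ∞]`. -/
def rectAvg (f : ℝ × ℝ → ℝ≥0∞) (r : (ℤ × ℤ) × (ℤ × ℤ)) : ℝ≥0∞ :=
  (volume (drect r))⁻¹ * ∫⁻ z in drect r, f z

theorem rectAvg_eq {f : ℝ × ℝ → ℝ≥0∞} (hf : Measurable f) (r : (ℤ × ℤ) × (ℤ × ℤ)) :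
    rectAvg f r = lavg (fun y => lavg (fun x => f (x, y)) r.1) r.2 := by
  have hm : Measurable fun y => ∫⁻ x in dyadic r.1, f (x, y) := hf.lintegral_prod_left'
  rw [rectAvg, volume_drect, drect, Measure.volume_eq_prod,
    setLIntegral_prod_symm _ hf.aemeasurable]
  simp only [lavg]
  rw [lintegral_const_mul _ hm, ENNReal.mul_inv (Or.inl (volume_dyadic_ne_zero _))
    (Or.inl (volume_dyadic_ne_top _)), ← mul_assoc, mul_comm (volume (dyadic r.1))⁻¹]

/-- The dyadic strong maximal function over a finite set of dyadic rectangles. -/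
def smax (F : Finset ((ℤ × ℤ) × (ℤ × ℤ))) (f : ℝ × ℝ → ℝ≥0∞) : ℝ × ℝ → ℝ≥0∞ :=
  supInd F drect (rectAvg f)

/-- The dyadic strong maximal function is bounded on `L²`. -/
theorem lintegral_smax_sq_le (F : Finset ((ℤ × ℤ) × (ℤ × ℤ))) {f : ℝ × ℝ → ℝ≥0∞}
    (hf : Measurable f) : ∫⁻ z, smax F f z ^ 2 ≤ 16 * ∫⁻ z, f z ^ 2 := by
  set F₁ := F.image Prod.fst
  set F₂ := F.image Prod.snd
  have hlm : ∀ p, Measurable fun y => lavg (fun x => f (x, y)) p := fun p =>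
    (hf.lintegral_prod_left' (μ := volume.restrict (dyadic p))).const_mul _
  have hm1 : Measurable fun w : ℝ × ℝ => dmax F₁ (fun x => f (x, w.2)) w.1 := by
    unfold dmax supInd
    refine measurable_finset_sup _ fun p _ => ?_
    exact ((hlm p).comp measurable_snd).indicator (measurable_fst (measurableSet_dyadic p))
  have hm1' : ∀ x, Measurable fun y => dmax F₁ (fun x => f (x, y)) x := fun x =>
    hm1.comp measurable_prodMk_left
  have hm2 : Measurable fun w : ℝ × ℝ =>
      dmax F₂ (fun y => dmax F₁ (fun x => f (x, y)) w.1) w.2 := by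
    unfold dmax supInd
    refine measurable_finset_sup _ fun p _ => ?_
    exact (((hm1.lintegral_prod_right' (ν := volume.restrict (dyadic p))).const_mul _).comp
      measurable_fst).indicator (measurable_snd (measurableSet_dyadic p))
  have hle : ∀ z : ℝ × ℝ, smax F f z ≤ dmax F₂ (fun y => dmax F₁ (fun x => f (x, y)) z.1) z.2 := by
    intro z
    refine supInd_le fun r hr hz => ?_
    rw [rectAvg_eq hf]
    refine le_trans (lavg_mono fun y _ => ?_) (le_supInd (Finset.mem_image_of_mem _ hr) hz.2)
    exact le_supInd (Finset.mem_image_of_mem _ hr) hz.1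
  calc ∫⁻ z, smax F f z ^ 2
      ≤ ∫⁻ z : ℝ × ℝ, dmax F₂ (fun y => dmax F₁ (fun x => f (x, y)) z.1) z.2 ^ 2 :=
        lintegral_mono fun z => pow_le_pow_left₀ zero_le (hle z) 2
    _ = ∫⁻ x, ∫⁻ y, dmax F₂ (fun y => dmax F₁ (fun x => f (x, y)) x) y ^ 2 := by
        rw [Measure.volume_eq_prod, lintegral_prod _ (hm2.pow_const 2).aemeasurable]
    _ ≤ ∫⁻ x, 4 * ∫⁻ y, dmax F₁ (fun x => f (x, y)) x ^ 2 :=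
        lintegral_mono fun x => lintegral_dmax_sq_le F₂ (hm1' x)
    _ = 4 * ∫⁻ y, ∫⁻ x, dmax F₁ (fun x => f (x, y)) x ^ 2 := by
        rw [lintegral_const_mul _ (hm1.pow_const 2).lintegral_prod_right',
          lintegral_lintegral_swap (hm1.pow_const 2).aemeasurable]
    _ ≤ 4 * ∫⁻ y, 4 * ∫⁻ x, f (x, y) ^ 2 := by
        gcongr with y
        exact lintegral_dmax_sq_le F₁ (hf.comp measurable_prodMk_right)
    _ = 16 * ∫⁻ z, f z ^ 2 := by
        rw [lintegral_const_mul _ (hf.pow_const 2).lintegral_prod_left', Measure.volume_eq_prod,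
          lintegral_prod_symm _ (hf.pow_const 2).aemeasurable, ← mul_assoc]
        norm_num

/-- The Carleson embedding theorem for dyadic rectangles. -/
theorem sum_mul_le_lintegral_supInd {F : Finset ((ℤ × ℤ) × (ℤ × ℤ))}
    {w t : (ℤ × ℤ) × (ℤ × ℤ) → ℝ≥0∞} {c : ℝ≥0∞}
    (hw : ∀ G : Finset ((ℤ × ℤ) × (ℤ × ℤ)), ∑ r ∈ G, w r ≤ c * volume (⋃ r ∈ G, drect r))
    (ht : ∀ r, t r ≠ ⊤) :
    ∑ r ∈ F, w r * t r ≤ c * ∫⁻ z, supInd F drect t z := by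
  have hN : Measurable (supInd F drect t) := measurable_supInd measurableSet_drect
  have h1 : ∑ r ∈ F, w r * t r = ∫⁻ r, t r ∂(∑ r ∈ F, w r • Measure.dirac r) := by
    simp
  rw [h1, lintegral_eq_lintegral_measure_lt _ (measurable_of_countable t) ht,
    lintegral_eq_lintegral_measure_lt _ hN (supInd_ne_top fun r _ => ht r)]
  have hmeas : Measurable fun s : ℝ => volume {z | ENNReal.ofReal s < supInd F drect t z} := by
    refine Antitone.measurable fun s s' h => measure_mono fun z hz => ?_
    exact lt_of_le_of_lt (ENNReal.ofReal_le_ofReal h) hz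
  rw [← lintegral_const_mul _ hmeas]
  refine lintegral_mono fun s => ?_
  rw [setOf_lt_supInd]
  refine le_trans (le_of_eq ?_) (hw _)
  rw [Finset.sum_filter, Measure.finsetSum_apply]
  refine Finset.sum_congr rfl fun r _ => ?_
  by_cases h : ENNReal.ofReal s < t r <;> simp [h]

theorem inv_sq_rectAvg_le {f : ℝ × ℝ → ℝ≥0∞} (hf : Measurable f) {r : (ℤ × ℤ) × (ℤ × ℤ)}
    (h0 : ∀ z ∈ drect r, f z ≠ 0) (ht : ∀ z ∈ drect r, f z ≠ ⊤) :
    (rectAvg f r ^ 2)⁻¹ ≤ (volume (drect r))⁻¹ * ∫⁻ z in drect r, (f z ^ 2)⁻¹ := by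
  have hV0 := volume_drect_ne_zero r
  have hVt := volume_drect_ne_top r
  have h := measure_pow_three_le (μ := volume) (measurableSet_drect r) hf h0 ht
  have hI : ∫⁻ z in drect r, f z = volume (drect r) * rectAvg f r := by
    rw [rectAvg, ← mul_assoc, ENNReal.mul_inv_cancel hV0 hVt, one_mul]
  rw [hI] at h
  set V := volume (drect r)
  set K := ∫⁻ z in drect r, (f z ^ 2)⁻¹
  have h2 : V ≤ rectAvg f r ^ 2 * K := by
    have hV2 : V ^ 2 ≠ 0 := pow_ne_zero 2 hV0
    rw [← ENNReal.mul_le_mul_iff_right hV2 (ENNReal.pow_ne_top hVt)]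
    calc V ^ 2 * V = V ^ 3 := by ring
      _ ≤ _ := h
      _ = _ := by ring
  rw [mul_comm, ← div_eq_mul_inv, ENNReal.le_div_iff_mul_le (Or.inl hV0) (Or.inl hVt), mul_comm,
    ← div_eq_mul_inv]
  exact ENNReal.div_le_of_le_mul' h2

/-- The duality between product `BMO` and `H¹`, the latter described by a square function `f ^ 4`
with finitely many terms. -/
theorem sq_sum_mul_le_of_carleson {F : Finset ((ℤ × ℤ) × (ℤ × ℤ))}
    {L a : (ℤ × ℤ) × (ℤ × ℤ) → ℝ≥0∞} {c : ℝ≥0∞} {f : ℝ × ℝ → ℝ≥0∞}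
    (hL : ∀ G : Finset ((ℤ × ℤ) × (ℤ × ℤ)), ∑ r ∈ G, L r ^ 2 ≤ c * volume (⋃ r ∈ G, drect r))
    (ha : ∀ r, a r ≠ ⊤) (hf : Measurable f)
    (hfa : ∀ z, f z ^ 4
      = ∑ r ∈ F, (drect r).indicator (fun _ => a r ^ 2 * (volume (drect r))⁻¹) z) :
    (∑ r ∈ F, L r * a r) ^ 2 ≤ 16 * c * (∫⁻ z, f z ^ 2) ^ 2 := by
  have hbd : ∀ z, f z ≤ 1 + ∑ r ∈ F, a r ^ 2 * (volume (drect r))⁻¹ := by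
    intro z
    by_cases h1 : f z ≤ 1
    · exact h1.trans le_self_add
    · refine le_trans (le_self_pow₀ (le_of_not_ge h1) four_ne_zero) ?_
      rw [hfa]
      refine le_trans (Finset.sum_le_sum fun r _ => ?_) le_add_self
      exact Set.indicator_le_self' (fun _ _ => zero_le) z
  have hbt : 1 + ∑ r ∈ F, a r ^ 2 * (volume (drect r))⁻¹ ≠ ⊤ := by
    refine ENNReal.add_ne_top.2 ⟨ENNReal.one_ne_top, ENNReal.sum_ne_top.2 fun r _ => ?_⟩
    exact ENNReal.mul_ne_top (ENNReal.pow_ne_top (ha r))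
      (ENNReal.inv_ne_top.2 (volume_drect_ne_zero r))
  have hft : ∀ z, f z ≠ ⊤ := fun z => ne_top_of_le_ne_top hbt (hbd z)
  have hmt : ∀ r, rectAvg f r ≠ ⊤ := by
    intro r
    refine ENNReal.mul_ne_top (ENNReal.inv_ne_top.2 (volume_drect_ne_zero r)) ?_
    refine ne_top_of_le_ne_top ?_ (lintegral_mono hbd)
    rw [setLIntegral_const]
    exact ENNReal.mul_ne_top hbt (volume_drect_ne_top r)
  have hf0 : ∀ r ∈ F, a r ≠ 0 → ∀ z ∈ drect r, f z ≠ 0 := by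
    intro r hr har z hz h
    have h4 := hfa z
    rw [h, zero_pow four_ne_zero, eq_comm, Finset.sum_eq_zero_iff] at h4
    have h5 := h4 r hr
    rw [Set.indicator_of_mem hz] at h5
    exact mul_ne_zero (pow_ne_zero 2 har) (ENNReal.inv_ne_zero.2 (volume_drect_ne_top r)) h5
  have hJ : ∀ r ∈ F, a r ^ 2 * (rectAvg f r ^ 2)⁻¹
      ≤ a r ^ 2 * ((volume (drect r))⁻¹ * ∫⁻ z in drect r, (f z ^ 2)⁻¹) := by
    intro r hr
    by_cases har : a r = 0
    · simp [har]
    · gcongr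
      exact inv_sq_rectAvg_le hf (hf0 r hr har) fun z _ => hft z
  have hm0 : ∀ r ∈ F, a r ≠ 0 → rectAvg f r ≠ 0 := by
    intro r hr har h
    refine mul_ne_zero (ENNReal.inv_ne_zero.2 (volume_drect_ne_top r)) (fun h0 => ?_) h
    rw [lintegral_eq_zero_iff hf, Filter.EventuallyEq,
      ae_restrict_iff' (measurableSet_drect r)] at h0
    refine volume_drect_ne_zero r (measure_mono_null (fun z hz => ?_) h0)
    exact fun hz' => hf0 r hr har z hz (hz' hz)
  have hcs : ∑ r ∈ F, L r * a r ≤ ∑ r ∈ F, (L r * rectAvg f r) * (a r * (rectAvg f r)⁻¹) := by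
    refine Finset.sum_le_sum fun r hr => ?_
    by_cases har : a r = 0
    · simp [har]
    · rw [mul_mul_mul_comm, ENNReal.mul_inv_cancel (hm0 r hr har) (hmt r),
        mul_one]
  have hA : ∑ r ∈ F, (L r * rectAvg f r) ^ 2 ≤ c * (16 * ∫⁻ z, f z ^ 2) := by
    simp only [mul_pow]
    refine le_trans (sum_mul_le_lintegral_supInd hL fun r => ENNReal.pow_ne_top (hmt r)) ?_
    gcongr
    refine le_trans (lintegral_mono fun z => ?_) (lintegral_smax_sq_le F hf)
    exact supInd_le fun r hr hz => pow_le_pow_left₀ zero_le (le_supInd hr hz) 2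
  have hB : ∑ r ∈ F, (a r * (rectAvg f r)⁻¹) ^ 2 ≤ ∫⁻ z, f z ^ 2 := by
    calc ∑ r ∈ F, (a r * (rectAvg f r)⁻¹) ^ 2
        = ∑ r ∈ F, a r ^ 2 * (rectAvg f r ^ 2)⁻¹ := by simp only [mul_pow, ENNReal.inv_pow]
      _ ≤ ∑ r ∈ F, ∫⁻ z, (drect r).indicator (fun _ => a r ^ 2 * (volume (drect r))⁻¹) z
            * (f z ^ 2)⁻¹ := by
          refine Finset.sum_le_sum fun r hr => (hJ r hr).trans (le_of_eq ?_)
          rw [← mul_assoc, ← lintegral_const_mul _ (by fun_prop),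
            ← lintegral_indicator (measurableSet_drect r)]
          refine lintegral_congr fun z => ?_
          by_cases hz : z ∈ drect r <;> simp [hz]
      _ = ∫⁻ z, f z ^ 4 * (f z ^ 2)⁻¹ := by
          rw [← lintegral_finsetSum]
          · simp only [← Finset.sum_mul, hfa]
          · exact fun r _ => (measurable_const.indicator (measurableSet_drect r)).mul
              (by fun_prop)
      _ ≤ ∫⁻ z, f z ^ 2 := by
          refine lintegral_mono fun z => ?_
          calc f z ^ 4 * (f z ^ 2)⁻¹ = f z ^ 2 * (f z ^ 2 * (f z ^ 2)⁻¹) := by ring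
            _ ≤ f z ^ 2 * 1 := by
              gcongr
              exact ENNReal.mul_inv_le_one _
            _ = _ := mul_one _
  calc (∑ r ∈ F, L r * a r) ^ 2
      ≤ (∑ r ∈ F, (L r * rectAvg f r) * (a r * (rectAvg f r)⁻¹)) ^ 2 :=
        pow_le_pow_left₀ zero_le hcs 2
    _ ≤ _ := sq_sum_mul_le F _ _
    _ ≤ c * (16 * ∫⁻ z, f z ^ 2) * ∫⁻ z, f z ^ 2 := mul_le_mul' hA hB
    _ = _ := by ring

theorem exists_measurable_majorant {u : (ℤ × ℤ) → ℝ → ℝ} (hu : u ∈ Adm) :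
    ∃ (F : Finset (ℤ × ℤ)) (v : (ℤ × ℤ) → ℝ → ℝ≥0∞), (∀ p, p ∉ F → u p = 0) ∧
      (∀ p, Measurable (v p)) ∧ (∀ p, ∫⁻ x, v p x ^ 2 ≠ ⊤) ∧
      (∀ p q, ENNReal.ofReal |avg (u p) q| ≤ lavg (v p) q) ∧
      ∑ p ∈ F, ∫⁻ x, v p x ^ 2 = 1 := by
  obtain ⟨hu2, hfin, hsum⟩ := hu
  have hae := fun p => (hu2 p).1.ae_eq_mk
  have hint : ∀ p, ∫⁻ x, ‖(hu2 p).1.mk (u p) x‖ₑ ^ 2 = ENNReal.ofReal (∫ x, u p x ^ 2) := by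
    intro p
    rw [ofReal_integral_eq_lintegral_ofReal (hu2 p).integrable_sq
      (Filter.Eventually.of_forall fun x => sq_nonneg _)]
    refine lintegral_congr_ae ?_
    filter_upwards [hae p] with x hx
    rw [← hx, ← sq_abs, ENNReal.ofReal_pow (abs_nonneg _), Real.enorm_eq_ofReal_abs]
  have hF : ∀ p, p ∉ hfin.toFinset → u p = 0 := fun p hp => by simpa using hp
  refine ⟨hfin.toFinset, fun p x => ‖(hu2 p).1.mk (u p) x‖ₑ, hF,
    fun p => (hu2 p).1.stronglyMeasurable_mk.measurable.enorm, fun p => ?_, fun p q => ?_, ?_⟩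
  · rw [hint p]
    exact ENNReal.ofReal_ne_top
  · rw [avg, abs_mul, ENNReal.ofReal_mul (abs_nonneg _), lavg, volume_dyadic,
      abs_of_pos (inv_pos.2 (dlen_pos q)), ENNReal.ofReal_inv_of_pos (dlen_pos q)]
    gcongr
    rw [← Real.enorm_eq_ofReal_abs]
    refine (enorm_integral_le_lintegral_enorm _).trans (le_of_eq ?_)
    refine lintegral_congr_ae (ae_restrict_of_ae ?_)
    filter_upwards [hae p] with x hx
    rw [← hx]
  · simp only [hint]
    rw [← ENNReal.ofReal_sum_of_nonneg fun p _ => integral_nonneg fun x => sq_nonneg _,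
      ← tsum_eq_sum (L := .unconditional _), hsum, ENNReal.ofReal_one]
    intro p hp
    simp [hF p hp]

/-- The square function majorant built from the maximal functions of a family of functions. -/
theorem lintegral_sum_dmax_sq_le {F F' : Finset (ℤ × ℤ)} {v : (ℤ × ℤ) → ℝ → ℝ≥0∞}
    (hv : ∀ p, Measurable (v p)) :
    ∫⁻ z : ℝ × ℝ, ∑ p ∈ F, dmax F' (v p) z.1 ^ 2
        * (dyadic p).indicator (fun _ => (volume (dyadic p))⁻¹) z.2
      ≤ 4 * ∑ p ∈ F, ∫⁻ x, v p x ^ 2 := by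
  have hi : ∀ p, Measurable ((dyadic p).indicator fun _ : ℝ => (volume (dyadic p))⁻¹) := fun p =>
    measurable_const.indicator (measurableSet_dyadic p)
  have hd := fun p => measurable_dmax F' (v p)
  rw [lintegral_finsetSum _ fun p _ => by have := hi p; have := hd p; fun_prop, Finset.mul_sum]
  refine Finset.sum_le_sum fun p _ => ?_
  rw [Measure.volume_eq_prod, lintegral_prod_mul ((hd p).pow_const 2).aemeasurable
    (hi p).aemeasurable, lintegral_indicator_const (measurableSet_dyadic p),
    ENNReal.inv_mul_cancel (volume_dyadic_ne_zero p) (volume_dyadic_ne_top p), mul_one]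
  exact lintegral_dmax_sq_le F' (hv p)

theorem sum_sq_le_prodBMO (lam : ParaSeq) (G : Finset ((ℤ × ℤ) × (ℤ × ℤ))) :
    ∑ r ∈ G, ENNReal.ofReal |lam r.1 r.2| ^ 2
      ≤ prodBMO lam ^ 2 * volume (⋃ r ∈ G, drect r) := by
  rcases G.eq_empty_or_nonempty with rfl | ⟨r₀, hr₀⟩
  · simp
  set Ω := ⋃ r ∈ G, drect r
  have hsub : ∀ r ∈ G, drect r ⊆ Ω := fun r hr => Set.subset_biUnion_of_mem (u := drect) hr
  have hpos : volume Ω ≠ 0 := fun h =>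
    volume_drect_ne_zero r₀ (measure_mono_null (hsub r₀ hr₀) h)
  have hfin : volume Ω ≠ ⊤ :=
    ne_top_of_le_ne_top (ENNReal.sum_ne_top.2 fun r _ => volume_drect_ne_top r)
      (measure_biUnion_finset_le G drect)
  have hΩ : Ω ∈ ProdOpen := by
    refine ⟨G.measurableSet_biUnion fun r _ => measurableSet_drect r, pos_iff_ne_zero.2 hpos,
      hfin.lt_top, fun z hz => ?_⟩
    obtain ⟨r, hr, hzr⟩ := Set.mem_iUnion₂.1 hz
    exact ⟨r.1, r.2, hzr, hsub r hr⟩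
  have h := le_iSup (fun Ω : ProdOpen => ((volume Ω.1)⁻¹ *
      ∑' r : {r : (ℤ × ℤ) × (ℤ × ℤ) // dyadic r.1 ×ˢ dyadic r.2 ⊆ Ω.1},
        ENNReal.ofReal ((lam r.1.1 r.1.2) ^ 2)) ^ (1/2 : ℝ)) ⟨Ω, hΩ⟩
  have h' := pow_le_pow_left₀ zero_le h 2
  rw [← ENNReal.rpow_two, ← ENNReal.rpow_mul] at h'
  norm_num at h'
  rw [mul_comm, ← div_eq_mul_inv, ENNReal.div_le_iff hpos hfin] at h'
  refine le_trans ?_ h'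
  refine le_trans ?_ (tsum_subtype {r : (ℤ × ℤ) × (ℤ × ℤ) | dyadic r.1 ×ˢ dyadic r.2 ⊆ Ω}
    fun r => ENNReal.ofReal (lam r.1 r.2 ^ 2)).ge
  refine le_trans (Finset.sum_le_sum fun r hr => ?_) (ENNReal.sum_le_tsum G)
  rw [Set.indicator_of_mem (show r ∈ {r : (ℤ × ℤ) × (ℤ × ℤ) | dyadic r.1 ×ˢ dyadic r.2 ⊆ Ω} from
    hsub r hr),
    ← ENNReal.ofReal_pow (abs_nonneg _), sq_abs]

/-- The bilinear form estimate for families of functions with values in `[0, ∞]`. -/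
theorem sq_sum_lavg_mul_lavg_le {L : (ℤ × ℤ) × (ℤ × ℤ) → ℝ≥0∞} {c : ℝ≥0∞}
    (hL : ∀ G : Finset ((ℤ × ℤ) × (ℤ × ℤ)), ∑ r ∈ G, L r ^ 2 ≤ c * volume (⋃ r ∈ G, drect r))
    {F₁ F₂ : Finset (ℤ × ℤ)} {u g : (ℤ × ℤ) → ℝ → ℝ≥0∞}
    (hu : ∀ p, Measurable (u p)) (hg : ∀ p, Measurable (g p))
    (hut : ∀ p, ∫⁻ x, u p x ^ 2 ≠ ⊤) (hgt : ∀ p, ∫⁻ x, g p x ^ 2 ≠ ⊤) :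
    (∑ r ∈ F₁ ×ˢ F₂, L r * (lavg (g r.2) r.1 * lavg (u r.1) r.2)) ^ 2
      ≤ 256 * c * ((∑ p ∈ F₂, ∫⁻ x, g p x ^ 2) * ∑ p ∈ F₁, ∫⁻ x, u p x ^ 2) := by
  set a : (ℤ × ℤ) × (ℤ × ℤ) → ℝ≥0∞ := fun r => lavg (g r.2) r.1 * lavg (u r.1) r.2 with ha
  have hat : ∀ r, a r ≠ ⊤ := fun r =>
    ENNReal.mul_ne_top (lavg_ne_top (hg _) (hgt _) _) (lavg_ne_top (hu _) (hut _) _)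
  set S : ℝ × ℝ → ℝ≥0∞ := fun z => ∑ r ∈ F₁ ×ˢ F₂,
    (drect r).indicator (fun _ => a r ^ 2 * (volume (drect r))⁻¹) z with hSdef
  have hS : Measurable S := by
    refine Finset.measurable_fun_sum _ fun r _ => ?_
    exact measurable_const.indicator (measurableSet_drect r)
  have h4 : ∀ z, (S z ^ (1 / 4 : ℝ)) ^ 4 = S z := fun z => by
    rw [← ENNReal.rpow_natCast, ← ENNReal.rpow_mul]
    norm_num
  have h2 : ∀ z, (S z ^ (1 / 4 : ℝ)) ^ 2 = S z ^ (1 / 2 : ℝ) := fun z => by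
    rw [← ENNReal.rpow_natCast, ← ENNReal.rpow_mul]
    norm_num
  have hhalf : ∀ t : ℝ≥0∞, (t ^ (1 / 2 : ℝ)) ^ 2 = t := fun t => by
    rw [← ENNReal.rpow_natCast, ← ENNReal.rpow_mul]
    norm_num
  have key := sq_sum_mul_le_of_carleson (F := F₁ ×ˢ F₂) (f := fun z => S z ^ (1 / 4 : ℝ)) hL hat
    (by fun_prop) h4
  simp only [h2] at key
  set P : ℝ × ℝ → ℝ≥0∞ := fun z => ∑ p ∈ F₂, dmax F₁ (g p) z.1 ^ 2
    * (dyadic p).indicator (fun _ => (volume (dyadic p))⁻¹) z.2 with hPdef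
  set Q : ℝ × ℝ → ℝ≥0∞ := fun z => ∑ p ∈ F₁, dmax F₂ (u p) z.1 ^ 2
    * (dyadic p).indicator (fun _ => (volume (dyadic p))⁻¹) z.2 with hQdef
  have hmeas : ∀ (F F' : Finset (ℤ × ℤ)) (v : (ℤ × ℤ) → ℝ → ℝ≥0∞),
      Measurable fun z : ℝ × ℝ => ∑ p ∈ F, dmax F' (v p) z.1 ^ 2
        * (dyadic p).indicator (fun _ => (volume (dyadic p))⁻¹) z.2 := by
    intro F F' v
    refine Finset.measurable_fun_sum _ fun p _ => ?_
    exact (((measurable_dmax F' (v p)).comp measurable_fst).pow_const 2).mul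
      ((measurable_const.indicator (measurableSet_dyadic p)).comp measurable_snd)
  have hP : Measurable P := hmeas F₂ F₁ g
  have hQ : Measurable Q := hmeas F₁ F₂ u
  have hSPQ : ∀ z, S z ≤ P z * Q z.swap := by
    intro z
    simp only [hSdef, hPdef, hQdef]
    rw [Finset.sum_mul_sum, Finset.sum_product_right]
    refine Finset.sum_le_sum fun J hJ => Finset.sum_le_sum fun I hI => ?_
    by_cases hz : z ∈ drect (I, J)
    · have h1 : z.1 ∈ dyadic I := hz.1
      have h2 : z.2 ∈ dyadic J := hz.2
      simp only [Set.indicator_of_mem hz, Prod.fst_swap, Prod.snd_swap, Set.indicator_of_mem h1,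
        Set.indicator_of_mem h2, ha]
      rw [volume_drect, ENNReal.mul_inv (Or.inl (volume_dyadic_ne_zero _))
        (Or.inl (volume_dyadic_ne_top _)), mul_pow]
      calc _ ≤ dmax F₁ (g J) z.1 ^ 2 * dmax F₂ (u I) z.2 ^ 2
            * ((volume (dyadic I))⁻¹ * (volume (dyadic J))⁻¹) := by
            gcongr
            · exact le_supInd hI h1
            · exact le_supInd hJ h2
        _ = _ := by ring
    · rw [Set.indicator_of_notMem hz]
      exact zero_le
  have hQs : ∫⁻ z : ℝ × ℝ, Q z.swap = ∫⁻ z, Q z := by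
    rw [Measure.volume_eq_prod, lintegral_prod_swap]
  have hPI : ∫⁻ z, P z ≤ 4 * ∑ p ∈ F₂, ∫⁻ x, g p x ^ 2 := lintegral_sum_dmax_sq_le hg
  have hQI : ∫⁻ z, Q z ≤ 4 * ∑ p ∈ F₁, ∫⁻ x, u p x ^ 2 := lintegral_sum_dmax_sq_le hu
  clear_value S P Q
  have hI : (∫⁻ z, S z ^ (1 / 2 : ℝ)) ^ 2
      ≤ (4 * ∑ p ∈ F₂, ∫⁻ x, g p x ^ 2) * (4 * ∑ p ∈ F₁, ∫⁻ x, u p x ^ 2) := by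
    calc (∫⁻ z, S z ^ (1 / 2 : ℝ)) ^ 2
        ≤ (∫⁻ z : ℝ × ℝ, P z ^ (1 / 2 : ℝ) * Q z.swap ^ (1 / 2 : ℝ)) ^ 2 := by
          refine pow_le_pow_left₀ zero_le (lintegral_mono fun z => ?_) 2
          rw [← ENNReal.mul_rpow_of_nonneg _ _ (by norm_num)]
          exact ENNReal.rpow_le_rpow (hSPQ z) (by norm_num)
      _ ≤ (∫⁻ z, (P z ^ (1 / 2 : ℝ)) ^ 2) * ∫⁻ z : ℝ × ℝ, (Q z.swap ^ (1 / 2 : ℝ)) ^ 2 :=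
          sq_lintegral_mul_le (hP.pow_const _).aemeasurable
            ((hQ.comp measurable_swap).pow_const _).aemeasurable
      _ ≤ _ := by
          simp only [hhalf, hQs]
          exact mul_le_mul' hPI hQI
  calc _ ≤ _ := key
    _ ≤ 16 * c * ((4 * ∑ p ∈ F₂, ∫⁻ x, g p x ^ 2) * (4 * ∑ p ∈ F₁, ∫⁻ x, u p x ^ 2)) := by
        gcongr
    _ = _ := by ring

/-- there is an absolute constant `C > 0` with `‖λ‖_{X'} ≤ C ‖λ‖_{BMO_prod}`
for every sequence `λ`; in particular product BMO implies unconditional boundedness of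
`P_λ`. -/
theorem Xprime_le_prodBMO :
    ∃ C : ℝ, 0 < C ∧ ∀ lam : ParaSeq, Xprime lam ≤ ENNReal.ofReal C * prodBMO lam := by
  refine ⟨16, by norm_num, fun lam => iSup₂_le fun u g => ?_⟩
  obtain ⟨F₁, u', hu0, hum, hut, hule, hu1⟩ := exists_measurable_majorant u.2
  obtain ⟨F₂, g', hg0, hgm, hgt, hgle, hg1⟩ := exists_measurable_majorant g.2
  have key := sq_sum_lavg_mul_lavg_le (F₁ := F₁) (F₂ := F₂) (sum_sq_le_prodBMO lam) hum hgm hut hgt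
  rw [hu1, hg1, mul_one, mul_one] at key
  have hzero : ∀ r : (ℤ × ℤ) × (ℤ × ℤ), r ∉ F₁ ×ˢ F₂ →
      |lam r.1 r.2 * avg (g.1 r.2) r.1 * avg (u.1 r.1) r.2| = 0 := by
    intro r hr
    rw [Finset.mem_product, not_and_or] at hr
    rcases hr with hr | hr
    · simp [hu0 _ hr, avg]
    · simp [hg0 _ hr, avg]
  rw [tsum_eq_sum hzero, ENNReal.ofReal_sum_of_nonneg fun r _ => abs_nonneg _]
  refine (ENNReal.pow_le_pow_left_iff two_ne_zero).1 (le_trans ?_ (key.trans (le_of_eq ?_)))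
  · refine pow_le_pow_left₀ zero_le (Finset.sum_le_sum fun r _ => ?_) 2
    rw [mul_assoc, abs_mul, abs_mul, ENNReal.ofReal_mul (abs_nonneg _),
      ENNReal.ofReal_mul (abs_nonneg _)]
    gcongr
    · exact hgle _ _
    · exact hule _ _
  · rw [mul_pow]
    norm_num

end
end

section
/- Define the sequence λ by λ_{IJ} := 2^{-j/2} if I = [0,1) and J = [0,2^{-j}) for some j ∈ ℕ, and λ_{IJ} := 0 otherwise. Then ‖λ‖_{BMO_prod} < ∞, but the operator M_λ is unbounded on ℓ²_ℤ(L²(ℝ²)), i.e. ‖M_λ‖ = ∞. Hence the M_λ condition is not necessary for λ to lie in product BMO (and in particular not necessary for the boundedness of P_λ). -/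
open MeasureTheory
open scoped ENNReal

noncomputable section

/-- `I_i(x)`: (the encoding of) the unique dyadic interval of length `2^{-i}` containing `x`. -/
def Iat (i : ℤ) (x : ℝ) : ℤ × ℤ := (i, ⌊(2:ℝ) ^ i * x⌋)

/-- The matrix entries `M_λ^{ij}(x,y) = 2^{(i+j)/2} λ_{I_i(x) I_j(y)}`. -/
def Ment (lam : ParaSeq) (i j : ℤ) (z : ℝ × ℝ) : ℝ :=
  (2:ℝ) ^ (((i : ℝ) + (j : ℝ)) / 2) * lam (Iat i z.1) (Iat j z.2)

/-- `(M_λ a)_j(x,y) = Σ_i M_λ^{ij}(x,y) a_i(x,y)`. -/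
def Mapply (lam : ParaSeq) (a : ℤ → ℝ × ℝ → ℝ) (j : ℤ) (z : ℝ × ℝ) : ℝ :=
  ∑' i : ℤ, Ment lam i j z * a i z

/-- The unit ball of `ℓ²_ℤ(L²(ℝ²))` (measurable representatives). -/
def Mball : Set (ℤ → ℝ × ℝ → ℝ) :=
  {a | (∀ i, Measurable (a i)) ∧ (∑' i : ℤ, ∫⁻ z : ℝ × ℝ, ENNReal.ofReal ((a i z) ^ 2)) ≤ 1}

/-- The operator norm `‖M_λ‖` of `M_λ` on `ℓ²_ℤ(L²(ℝ²))`, as an element of `[0, ∞]`. -/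
def MopNorm (lam : ParaSeq) : ℝ≥0∞ :=
  ⨆ a : Mball,
    (∑' j : ℤ, ∫⁻ z : ℝ × ℝ, ENNReal.ofReal ((Mapply lam a.1 j z) ^ 2)) ^ (1/2 : ℝ)

open Classical in
/-- The sequence `λ_{IJ} = 2^{-j/2}` if `I = [0,1)` and `J = [0,2^{-j})`, `j ∈ ℕ`,
and `λ_{IJ} = 0` otherwise. -/
def lamEx : ParaSeq := fun p q =>
  if p = ((0 : ℤ), (0 : ℤ)) ∧ 0 ≤ q.1 ∧ q.2 = 0 then (2:ℝ) ^ (-((q.1 : ℝ)) / 2) else 0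

lemma lamEx_origin (j : ℕ) :
    lamEx (0, 0) ((j : ℤ), 0) = (2 : ℝ) ^ (-(j : ℝ) / 2) := by
  simp [lamEx]

lemma exists_nat_of_lamEx_ne_zero {p q : ℤ × ℤ} (h : lamEx p q ≠ 0) :
    ∃ j : ℕ, p = (0, 0) ∧ q = ((j : ℤ), 0) := by
  unfold lamEx at h
  split_ifs at h with hpq
  · obtain ⟨hp, hq, hq2⟩ := hpq
    exact ⟨q.1.toNat, hp, Prod.ext (by simp [hq]) hq2⟩
  · exact absurd rfl h

lemma ofReal_lamEx_origin_sq (j : ℕ) :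
    ENNReal.ofReal (lamEx (0, 0) ((j : ℤ), 0) ^ 2) = (2⁻¹ : ℝ≥0∞) ^ j := by
  have h : lamEx (0, 0) ((j : ℤ), 0) ^ 2 = (2⁻¹ : ℝ) ^ j := by
    rw [lamEx_origin, ← Real.rpow_natCast, ← Real.rpow_mul (by norm_num), inv_pow,
      ← Real.rpow_natCast, ← Real.rpow_neg (by norm_num)]
    congr 1
    push_cast
    ring
  rw [h, ENNReal.ofReal_pow (by norm_num), ENNReal.ofReal_inv_of_pos (by norm_num)]
  simp

lemma dyadic_origin (j : ℕ) : dyadic ((j : ℤ), 0) = Set.Ico 0 ((2⁻¹ : ℝ) ^ j) := by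
  simp [dyadic]

/-- The rectangle `[0,1) × [0,2^{-j})`. -/
def originRect (j : ℕ) : Set (ℝ × ℝ) := dyadic (0, 0) ×ˢ dyadic ((j : ℤ), 0)

lemma mem_originRect {j : ℕ} {z : ℝ × ℝ} :
    z ∈ originRect j ↔ (0 ≤ z.1 ∧ z.1 < 1) ∧ 0 ≤ z.2 ∧ z.2 < (2⁻¹ : ℝ) ^ j := by
  rw [originRect, dyadic_origin, Set.mem_prod]
  simp [dyadic]

lemma measurableSet_originRect (j : ℕ) : MeasurableSet (originRect j) :=
  measurableSet_Ico.prod measurableSet_Ico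

lemma originRect_anti : Antitone originRect := by
  intro i j hij z hz
  rw [mem_originRect] at hz ⊢
  exact ⟨hz.1, hz.2.1, hz.2.2.trans_le (pow_le_pow_of_le_one (by norm_num) (by norm_num) hij)⟩

lemma volume_originRect (j : ℕ) : volume (originRect j) = (2⁻¹ : ℝ≥0∞) ^ j := by
  rw [originRect, dyadic_origin, Measure.volume_eq_prod, Measure.prod_prod, Real.volume_Ico,
    sub_zero, ENNReal.ofReal_pow (by norm_num), ENNReal.ofReal_inv_of_pos (by norm_num)]
  simp [dyadic]

lemma tsum_lamEx_sq_le (Ω : Set (ℝ × ℝ)) :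
    ∑' r : {r : (ℤ × ℤ) × (ℤ × ℤ) // dyadic r.1 ×ˢ dyadic r.2 ⊆ Ω},
      ENNReal.ofReal ((lamEx r.1.1 r.1.2) ^ 2) ≤ 2 * volume Ω := by
  classical
  by_cases hex : ∃ j, originRect j ⊆ Ω
  · set m := Nat.find hex
    have hmΩ : originRect m ⊆ Ω := Nat.find_spec hex
    let e : ℕ → {r : (ℤ × ℤ) × (ℤ × ℤ) // dyadic r.1 ×ˢ dyadic r.2 ⊆ Ω} := fun k =>
      ⟨((0, 0), (((m + k : ℕ) : ℤ), 0)), (originRect_anti (Nat.le_add_right m k)).trans hmΩ⟩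
    have he : Function.Injective e := by
      intro k l hkl
      simpa [e] using hkl
    have hsupp : Function.support (fun r : {r : (ℤ × ℤ) × (ℤ × ℤ) //
        dyadic r.1 ×ˢ dyadic r.2 ⊆ Ω} => ENNReal.ofReal ((lamEx r.1.1 r.1.2) ^ 2)) ⊆
        Set.range e := by
      rintro ⟨⟨p, q⟩, hr⟩ hne
      have hlam : lamEx p q ≠ 0 := by
        intro h0
        simp [h0] at hne
      obtain ⟨j, rfl, rfl⟩ := exists_nat_of_lamEx_ne_zero hlam
      have hmj : m ≤ j := Nat.find_min' hex hr
      exact ⟨j - m, by simp [e, hmj]⟩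
    rw [← he.tsum_eq hsupp]
    calc ∑' k, ENNReal.ofReal ((lamEx (e k).1.1 (e k).1.2) ^ 2)
        = ∑' k : ℕ, (2⁻¹ : ℝ≥0∞) ^ m * 2⁻¹ ^ k := by
          refine tsum_congr fun k => ?_
          rw [← pow_add]
          exact ofReal_lamEx_origin_sq (m + k)
      _ = 2 * volume (originRect m) := by
          rw [ENNReal.tsum_mul_left, ENNReal.tsum_geometric, ENNReal.one_sub_inv_two, inv_inv,
            volume_originRect, mul_comm]
      _ ≤ 2 * volume Ω := by gcongr
  · refine le_of_eq_of_le (ENNReal.tsum_eq_zero.2 ?_) zero_le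
    rintro ⟨⟨p, q⟩, hr⟩
    by_contra hne
    have hlam : lamEx p q ≠ 0 := by
      intro h0
      simp [h0] at hne
    obtain ⟨j, rfl, rfl⟩ := exists_nat_of_lamEx_ne_zero hlam
    exact hex ⟨j, hr⟩

lemma prodBMO_lamEx_le : prodBMO lamEx ≤ 2 ^ (1 / 2 : ℝ) := by
  refine iSup_le fun ⟨Ω, hΩ⟩ => ?_
  obtain ⟨-, hpos, hfin, -⟩ := hΩ
  refine ENNReal.rpow_le_rpow ?_ (by norm_num)
  calc _ ≤ (volume Ω)⁻¹ * (2 * volume Ω) := by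
        gcongr
        exact tsum_lamEx_sq_le Ω
    _ = 2 := by
        rw [mul_comm, mul_assoc, ENNReal.mul_inv_cancel hpos.ne' hfin.ne, mul_one]

lemma Ment_lamEx_of_mem {j : ℕ} {z : ℝ × ℝ} (hz : z ∈ originRect j) :
    Ment lamEx 0 j z = 1 := by
  rw [mem_originRect] at hz
  obtain ⟨⟨hx0, hx1⟩, hy0, hy1⟩ := hz
  have hx : Iat 0 z.1 = (0, 0) := by
    simp [Iat, Int.floor_eq_zero_iff, hx0, hx1]
  have hy : Iat j z.2 = ((j : ℤ), 0) := by
    refine Prod.ext rfl (Int.floor_eq_zero_iff.2 ⟨by positivity, ?_⟩)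
    rw [zpow_natCast]
    calc (2 : ℝ) ^ j * z.2 < 2 ^ j * 2⁻¹ ^ j := by gcongr
      _ = 1 := by rw [← mul_pow]; norm_num
  rw [Ment, hx, hy, lamEx_origin, ← Real.rpow_add (by norm_num)]
  rw [show (((0 : ℤ) : ℝ) + ((j : ℤ) : ℝ)) / 2 + -(j : ℝ) / 2 = 0 by push_cast; ring]
  simp

/-- The `L²`-normalised indicator of `originRect n`, placed in the coordinate `0`. -/
def testSeq (n : ℕ) (i : ℤ) : ℝ × ℝ → ℝ :=
  if i = 0 then (originRect n).indicator fun _ => √(2 ^ n) else 0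

lemma testSeq_of_ne {n : ℕ} {i : ℤ} (hi : i ≠ 0) : testSeq n i = 0 := if_neg hi

lemma lintegral_testSeq_zero_sq (n : ℕ) :
    ∫⁻ z, ENNReal.ofReal (testSeq n 0 z ^ 2) = 1 := by
  have h : (fun z => ENNReal.ofReal (testSeq n 0 z ^ 2)) =
      (originRect n).indicator fun _ => (2 : ℝ≥0∞) ^ n := by
    ext z
    by_cases hz : z ∈ originRect n <;> simp [testSeq, hz, ENNReal.ofReal_pow]
  rw [h, lintegral_indicator_const (measurableSet_originRect n), volume_originRect, ← mul_pow,
    ENNReal.mul_inv_cancel (by norm_num) (by norm_num), one_pow]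

lemma testSeq_mem_Mball (n : ℕ) : testSeq n ∈ Mball := by
  refine ⟨fun i => ?_, ?_⟩
  · unfold testSeq
    split_ifs
    · exact measurable_const.indicator (measurableSet_originRect n)
    · exact measurable_const
  · rw [tsum_eq_single 0 fun i hi => by simp [testSeq_of_ne hi], lintegral_testSeq_zero_sq]

lemma Mapply_testSeq {n j : ℕ} (hj : j ≤ n) {z : ℝ × ℝ} (hz : z ∈ originRect n) :
    Mapply lamEx (testSeq n) j z = testSeq n 0 z := by
  rw [Mapply, tsum_eq_single 0 fun i hi => by simp [testSeq_of_ne hi],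
    Ment_lamEx_of_mem (originRect_anti hj hz), one_mul]

lemma one_le_lintegral_Mapply_testSeq_sq {n j : ℕ} (hj : j ≤ n) :
    1 ≤ ∫⁻ z, ENNReal.ofReal (Mapply lamEx (testSeq n) j z ^ 2) := by
  rw [← lintegral_testSeq_zero_sq n]
  refine lintegral_mono fun z => ?_
  by_cases hz : z ∈ originRect n
  · simp only [Mapply_testSeq hj hz, le_refl]
  · simp [testSeq, hz]

lemma natCast_rpow_le_MopNorm_lamEx (n : ℕ) : (n : ℝ≥0∞) ^ (1 / 2 : ℝ) ≤ MopNorm lamEx := by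
  refine le_iSup_of_le ⟨testSeq n, testSeq_mem_Mball n⟩ (ENNReal.rpow_le_rpow ?_ (by norm_num))
  calc (n : ℝ≥0∞) = ∑ _j ∈ Finset.range n, 1 := by simp
    _ ≤ ∑ j ∈ Finset.range n,
          ∫⁻ z, ENNReal.ofReal (Mapply lamEx (testSeq n) (j : ℤ) z ^ 2) :=
        Finset.sum_le_sum fun j hj =>
          one_le_lintegral_Mapply_testSeq_sq (Finset.mem_range.1 hj).le
    _ ≤ ∑' j : ℕ, ∫⁻ z, ENNReal.ofReal (Mapply lamEx (testSeq n) (j : ℤ) z ^ 2) :=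
        ENNReal.sum_le_tsum _
    _ ≤ _ := ENNReal.tsum_comp_le_tsum_of_injective Nat.cast_injective
        fun j : ℤ => ∫⁻ z, ENNReal.ofReal (Mapply lamEx (testSeq n) j z ^ 2)

/-- `lamEx` lies in product BMO, yet `‖M_{λ}‖ = ∞`: the `M_λ` condition is not
necessary for membership in product BMO (nor for boundedness of `P_λ`). -/
theorem prodBMO_finite_MopNorm_infinite : prodBMO lamEx < ⊤ ∧ MopNorm lamEx = ⊤ := by
  refine ⟨prodBMO_lamEx_le.trans_lt (ENNReal.rpow_lt_top_of_nonneg (by norm_num) (by norm_num)),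
    ENNReal.eq_top_of_forall_nnreal_le fun r => ?_⟩
  obtain ⟨n, hn⟩ := exists_nat_ge (r ^ 2)
  refine le_trans ?_ (natCast_rpow_le_MopNorm_lamEx n)
  rw [one_div, ENNReal.le_rpow_inv_iff (by norm_num), ENNReal.rpow_ofNat]
  exact_mod_cast hn

end
end
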